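/- For every ε ∈ (0,1) there exists a constant C > 0 such that for all integers n ≥ 2, all Δ ∈ (0, 1-ε], and all horizons t ∈ ℕ, the optimal mutual information satisfies I*_t ≤ C·t·Δ²·(log n)/n. -/

import Mathlib

open scoped BigOperators

noncomputable section

/-- Probability that pulling arm `a` yields reward `r : Bool` (with `true` = reward 1),
when the best arm is `astar`: `Bernoulli ((1+Δ)/2)` if `a = astar`, else `Bernoulli ((1-Δ)/2)`. -/
def rewP (n : ℕ) (Δ : ℝ) (astar a : Fin n) (r : Bool) : ℝ :=
  if r then (if a = astar then (1 + Δ) / 2 else (1 - Δ) / 2)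
  else 1 - (if a = astar then (1 + Δ) / 2 else (1 - Δ) / 2)

/-- An interactive algorithm: for every history (recorded with the most recent pull first),
a probability distribution over the `n` arms used to draw the next pull. -/
def IsAlg (n : ℕ) (alg : List (Fin n × Bool) → Fin n → ℝ) : Prop :=
  ∀ h : List (Fin n × Bool), (∀ a, 0 ≤ alg h a) ∧ (∑ a : Fin n, alg h a) = 1

/-- Probability, conditionally on the best arm `astar`, of observing a given history
(recorded with the most recent pull first) when running the algorithm `alg`. -/
def histP (n : ℕ) (alg : List (Fin n × Bool) → Fin n → ℝ) (Δ : ℝ) (astar : Fin n) :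
    List (Fin n × Bool) → ℝ
  | [] => 1
  | (a, r) :: prev => histP n alg Δ astar prev * alg prev a * rewP n Δ astar a r

/-- The reversed history (most recent pull first) associated with a tuple of `t` pulls. -/
def hist {n t : ℕ} (h : Fin t → Fin n × Bool) : List (Fin n × Bool) :=
  (List.ofFn h).reverse

/-- Success probability `P(a_{t+1} = a*)` of an interactive algorithm after `t` rounds,
under the uniform prior on the best arm. -/
def succProb (n t : ℕ) (alg : List (Fin n × Bool) → Fin n → ℝ) (Δ : ℝ) : ℝ :=
  ((n : ℝ))⁻¹ * ∑ astar : Fin n, ∑ h : Fin t → Fin n × Bool,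
    histP n alg Δ astar (hist h) * alg (hist h) astar

/-- Mutual information (in nats) `I(a*; H_t)` accumulated by an interactive algorithm. -/
def mutualInfo (n t : ℕ) (alg : List (Fin n × Bool) → Fin n → ℝ) (Δ : ℝ) : ℝ :=
  ∑ astar : Fin n, ∑ h : Fin t → Fin n × Bool,
    ((n : ℝ))⁻¹ * histP n alg Δ astar (hist h) *
      Real.log (histP n alg Δ astar (hist h) /
        (((n : ℝ))⁻¹ * ∑ b : Fin n, histP n alg Δ b (hist h)))

/-- Optimal success probability `p*_t`. -/
def pStar (n t : ℕ) (Δ : ℝ) : ℝ :=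
  sSup {x : ℝ | ∃ alg, IsAlg n alg ∧ x = succProb n t alg Δ}

/-- Optimal mutual information `I*_t`. -/
def IStar (n t : ℕ) (Δ : ℝ) : ℝ :=
  sSup {x : ℝ | ∃ alg, IsAlg n alg ∧ x = mutualInfo n t alg Δ}

/-- Reward distribution of a suboptimal arm: `Bernoulli ((1-Δ)/2)`. -/
def nullRewP (Δ : ℝ) (r : Bool) : ℝ := if r then (1 - Δ) / 2 else (1 + Δ) / 2

/-- Probability of a history when no arm is optimal (the reference measure). -/
def nullHistP (n : ℕ) (alg : List (Fin n × Bool) → Fin n → ℝ) (Δ : ℝ) :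
    List (Fin n × Bool) → ℝ
  | [] => 1
  | (a, r) :: prev => nullHistP n alg Δ prev * alg prev a * nullRewP Δ r

/-- Likelihood ratio of a history under best arm `b` against the reference measure. -/
def likRatio (n : ℕ) (Δ : ℝ) (b : Fin n) : List (Fin n × Bool) → ℝ
  | [] => 1
  | (a, r) :: prev => likRatio n Δ b prev * (rewP n Δ b a r / nullRewP Δ r)

lemma nullRewP_pos {Δ : ℝ} (h0 : 0 < Δ) (h1 : Δ < 1) (r : Bool) : 0 < nullRewP Δ r := by
  cases r <;> simp [nullRewP] <;> linarith

lemma rewP_pos {n : ℕ} {Δ : ℝ} (h0 : 0 < Δ) (h1 : Δ < 1) (b a : Fin n) (r : Bool) :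
    0 < rewP n Δ b a r := by
  cases r <;> simp only [rewP] <;> split_ifs <;> simp_all <;> linarith

lemma likRatio_pos {n : ℕ} {Δ : ℝ} (h0 : 0 < Δ) (h1 : Δ < 1) (b : Fin n)
    (l : List (Fin n × Bool)) : 0 < likRatio n Δ b l := by
  induction l with
  | nil => simp [likRatio]
  | cons x l ih => exact mul_pos ih (div_pos (rewP_pos h0 h1 _ _ _) (nullRewP_pos h0 h1 _))

lemma nullHistP_nonneg {n : ℕ} {alg : List (Fin n × Bool) → Fin n → ℝ} (halg : IsAlg n alg)
    {Δ : ℝ} (h0 : 0 < Δ) (h1 : Δ < 1) (l : List (Fin n × Bool)) :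
    0 ≤ nullHistP n alg Δ l := by
  induction l with
  | nil => simp [nullHistP]
  | cons x l ih => exact mul_nonneg (mul_nonneg ih ((halg l).1 _)) (nullRewP_pos h0 h1 _).le

lemma histP_eq_nullHistP_mul {n : ℕ} (alg : List (Fin n × Bool) → Fin n → ℝ)
    {Δ : ℝ} (h0 : 0 < Δ) (h1 : Δ < 1) (b : Fin n) (l : List (Fin n × Bool)) :
    histP n alg Δ b l = nullHistP n alg Δ l * likRatio n Δ b l := by
  induction l with
  | nil => simp [histP, nullHistP, likRatio]
  | cons x l ih =>
    have := (nullRewP_pos h0 h1 x.2).ne'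
    simp only [histP, nullHistP, likRatio, ih]
    field_simp

lemma sum_hist_succ {n t : ℕ} (f : List (Fin n × Bool) → ℝ) :
    ∑ h : Fin (t + 1) → Fin n × Bool, f (hist h) =
      ∑ h : Fin t → Fin n × Bool, ∑ x : Fin n × Bool, f (x :: hist h) := by
  rw [← (Fin.snocEquiv fun _ => Fin n × Bool).sum_comp, Fintype.sum_prod_type, Finset.sum_comm]
  refine Finset.sum_congr rfl fun h _ => Finset.sum_congr rfl fun x _ => ?_
  change f (hist (Fin.snoc (α := fun _ => Fin n × Bool) h x)) = _
  rw [hist, List.ofFn_succ_last]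
  simp [hist]

lemma sum_nullHistP {n : ℕ} {alg : List (Fin n × Bool) → Fin n → ℝ} (halg : IsAlg n alg)
    (Δ : ℝ) (t : ℕ) :
    ∑ h : Fin t → Fin n × Bool, nullHistP n alg Δ (hist h) = 1 := by
  induction t with
  | zero => simp [hist, nullHistP]
  | succ t ih =>
    rw [sum_hist_succ, ← ih]
    refine Finset.sum_congr rfl fun h _ => ?_
    simp only [Fintype.sum_prod_type, Fintype.sum_bool, nullHistP, ← mul_add]
    rw [← Finset.sum_mul, ← Finset.mul_sum, (halg _).2]
    simp [nullRewP]
    ring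

/-- The unnormalized sum over best arms of the divergence integrand `L - 1 - log L`. -/
def revDiv (n : ℕ) (Δ : ℝ) (l : List (Fin n × Bool)) : ℝ :=
  ∑ b : Fin n, (likRatio n Δ b l - 1 - Real.log (likRatio n Δ b l))

lemma sum_nullRewP_mul_revDiv {n : ℕ} {Δ : ℝ} (h0 : 0 < Δ) (h1 : Δ < 1) (a : Fin n)
    (l : List (Fin n × Bool)) :
    ∑ r : Bool, nullRewP Δ r * revDiv n Δ ((a, r) :: l) =
      revDiv n Δ l + Δ * Real.log ((1 + Δ) / (1 - Δ)) := by
  have hd : Δ * Real.log ((1 + Δ) / (1 - Δ)) =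
      ∑ b : Fin n, if a = b then Δ * Real.log ((1 + Δ) / (1 - Δ)) else 0 := by simp
  simp only [revDiv, Finset.mul_sum]
  rw [Finset.sum_comm, hd, ← Finset.sum_add_distrib]
  refine Finset.sum_congr rfl fun b _ => ?_
  have hL := likRatio_pos h0 h1 b l
  have hlog : ∀ r, Real.log (likRatio n Δ b ((a, r) :: l)) =
      Real.log (likRatio n Δ b l) + (Real.log (rewP n Δ b a r) - Real.log (nullRewP Δ r)) := by
    intro r
    have h2 := rewP_pos h0 h1 b a r
    have h3 := nullRewP_pos h0 h1 r
    rw [likRatio, Real.log_mul hL.ne' (div_pos h2 h3).ne', Real.log_div h2.ne' h3.ne']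
  have hmul : ∀ r, nullRewP Δ r * likRatio n Δ b ((a, r) :: l) =
      likRatio n Δ b l * rewP n Δ b a r := by
    intro r
    have h3 := (nullRewP_pos h0 h1 r).ne'
    rw [likRatio]; field_simp
  have hp : (0 : ℝ) < 1 + Δ := by linarith
  have hm : (0 : ℝ) < 1 - Δ := by linarith
  simp only [mul_sub, hmul, hlog, Fintype.sum_bool]
  rw [Real.log_div hp.ne' hm.ne']
  by_cases hab : a = b
  · have e : 1 - (1 + Δ) / 2 = (1 - Δ) / 2 := by ring
    simp [rewP, nullRewP, hab, e, Real.log_div, hp.ne', hm.ne']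
    ring
  · have e : 1 - (1 - Δ) / 2 = (1 + Δ) / 2 := by ring
    simp [rewP, nullRewP, hab, e]
    ring

lemma sum_nullHistP_mul_revDiv {n : ℕ} {alg : List (Fin n × Bool) → Fin n → ℝ}
    (halg : IsAlg n alg) {Δ : ℝ} (h0 : 0 < Δ) (h1 : Δ < 1) (t : ℕ) :
    ∑ h : Fin t → Fin n × Bool, nullHistP n alg Δ (hist h) * revDiv n Δ (hist h) =
      t * (Δ * Real.log ((1 + Δ) / (1 - Δ))) := by
  induction t with
  | zero => simp [hist, revDiv, likRatio]
  | succ t ih =>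
    rw [sum_hist_succ fun l => nullHistP n alg Δ l * revDiv n Δ l]
    have step : ∀ l : List (Fin n × Bool),
        ∑ x : Fin n × Bool, nullHistP n alg Δ (x :: l) * revDiv n Δ (x :: l) =
          nullHistP n alg Δ l * revDiv n Δ l +
            nullHistP n alg Δ l * (Δ * Real.log ((1 + Δ) / (1 - Δ))) := by
      intro l
      simp only [Fintype.sum_prod_type, nullHistP, mul_assoc]
      simp only [← Finset.mul_sum, sum_nullRewP_mul_revDiv h0 h1]
      rw [← Finset.sum_mul, (halg l).2]
      ring
    simp only [step, Finset.sum_add_distrib, ih, ← Finset.sum_mul, sum_nullHistP halg]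
    push_cast
    ring

lemma mul_log_sub_le_of_le_one {x : ℝ} (hx : 0 < x) (hx1 : x ≤ 1) :
    x * Real.log x - x + 1 ≤ 3 * (x - 1 - Real.log x) := by
  obtain ⟨s, hs, rfl⟩ : ∃ s : ℝ, 0 < s ∧ s ^ 2 = x :=
    ⟨√x, Real.sqrt_pos.2 hx, Real.sq_sqrt hx.le⟩
  have hs1 : s ≤ 1 := by nlinarith
  have hl := Real.log_le_sub_one_of_pos hs
  rw [Real.log_pow]
  push_cast
  have h2 := mul_le_mul_of_nonneg_left hl (sq_nonneg s)
  nlinarith [mul_nonneg (sub_nonneg.2 hs1) (sq_nonneg (s - 1))]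

lemma mul_log_sub_le_of_one_le {x : ℝ} (hx1 : 1 ≤ x) :
    x * Real.log x - x + 1 ≤ (1 + Real.log x) * (x - 1 - Real.log x) := by
  have h := Real.quadratic_le_exp_of_nonneg (Real.log_nonneg hx1)
  rw [Real.exp_log (by linarith)] at h
  nlinarith

lemma mul_log_sub_le {n : ℕ} (hn : 2 ≤ n) {x : ℝ} (hx : 0 < x) (hxn : x ≤ 2 * n) :
    x * Real.log x - x + 1 ≤ 10 * Real.log n * (x - 1 - Real.log x) := by
  have hn' : (2 : ℝ) ≤ n := by exact_mod_cast hn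
  have hl2 := Real.log_two_gt_d9
  have hln : Real.log 2 ≤ Real.log n := Real.log_le_log (by norm_num) hn'
  have hφ : 0 ≤ x - 1 - Real.log x := by linarith [Real.log_le_sub_one_of_pos hx]
  rcases le_total x 1 with h | h
  · refine (mul_log_sub_le_of_le_one hx h).trans (mul_le_mul_of_nonneg_right ?_ hφ)
    linarith
  · refine (mul_log_sub_le_of_one_le h).trans (mul_le_mul_of_nonneg_right ?_ hφ)
    have := Real.log_le_log hx hxn
    rw [Real.log_mul (by norm_num) (by positivity)] at this
    linarith

/-- Jensen-type gap of `x ↦ x log x`, bounded by the gap of `-log` at the cost of `log n`. -/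
lemma sum_mul_log_div_mean_le {n : ℕ} (hn : 2 ≤ n) (L : Fin n → ℝ) (hL : ∀ a, 0 < L a) :
    ∑ a, L a * Real.log (L a / ((n : ℝ)⁻¹ * ∑ b, L b)) ≤
      10 * Real.log n * ∑ a, (L a - 1 - Real.log (L a)) := by
  have hn' : (2 : ℝ) ≤ n := by exact_mod_cast hn
  have hn0 : (0 : ℝ) < n := by linarith
  have hl2 := Real.log_two_gt_d9
  have hl2' := Real.log_two_lt_d9
  have hln : Real.log 2 ≤ Real.log n := Real.log_le_log (by norm_num) hn'
  set M := (n : ℝ)⁻¹ * ∑ b, L b with hM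
  have hsum : ∑ b, L b = n * M := by rw [hM]; field_simp
  have hLM : ∀ a, L a ≤ n * M := fun a =>
    hsum ▸ Finset.single_le_sum (fun b _ => (hL b).le) (Finset.mem_univ a)
  have hMpos : 0 < M := by
    have := (hL ⟨0, by omega⟩).trans_le (hLM ⟨0, by omega⟩)
    exact pos_of_mul_pos_right this hn0.le
  have hlog : ∀ a, Real.log (L a / M) = Real.log (L a) - Real.log M := fun a =>
    Real.log_div (hL a).ne' hMpos.ne'
  rcases le_total M 2 with h | h
  · have hent : n * (M - 1) ≤ n * (M * Real.log M) := by
      gcongr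
      have := Real.one_sub_inv_le_log_of_pos hMpos
      have := mul_le_mul_of_nonneg_left this hMpos.le
      rwa [mul_sub, mul_inv_cancel₀ hMpos.ne', mul_one] at this
    calc ∑ a, L a * Real.log (L a / M)
        = ∑ a, L a * Real.log (L a) - n * (M * Real.log M) := by
          simp only [hlog, mul_sub, Finset.sum_sub_distrib, ← Finset.sum_mul, hsum]
          ring
      _ ≤ ∑ a, (L a * Real.log (L a) - L a + 1) := by
          simp only [Finset.sum_add_distrib, Finset.sum_sub_distrib, hsum]
          simp
          linarith
      _ ≤ _ := by
          rw [Finset.mul_sum]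
          refine Finset.sum_le_sum fun a _ => mul_log_sub_le hn (hL a) ?_
          nlinarith [hLM a]
  · have hupper : ∑ a, L a * Real.log (L a / M) ≤ n * M * Real.log n := by
      rw [← hsum, Finset.sum_mul]
      refine Finset.sum_le_sum fun a _ => mul_le_mul_of_nonneg_left ?_ (hL a).le
      exact Real.log_le_log (div_pos (hL a) hMpos) ((div_le_iff₀ hMpos).2 (hLM a))
    have hlogsum : ∑ a, Real.log (L a) ≤ n * Real.log M := by
      have : ∑ a, Real.log (L a / M) ≤ ∑ a, (L a / M - 1) :=
        Finset.sum_le_sum fun a _ => Real.log_le_sub_one_of_pos (div_pos (hL a) hMpos)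
      simp only [hlog, Finset.sum_sub_distrib, ← Finset.sum_div, hsum,
        mul_div_assoc, div_self hMpos.ne'] at this
      simp at this
      linarith
    have hlogM : Real.log M ≤ Real.log 2 + (M / 2 - 1) := by
      have := Real.log_le_sub_one_of_pos (half_pos hMpos)
      rw [Real.log_div hMpos.ne' two_ne_zero] at this
      linarith
    have hlower : n * (M / 10) ≤ ∑ a, (L a - 1 - Real.log (L a)) := by
      simp only [Finset.sum_sub_distrib, hsum]
      simp
      have : n * (M / 10) ≤ n * (M - 1 - Real.log M) := by
        gcongr
        linarith
      linarith
    have := mul_le_mul_of_nonneg_left hlower (show 0 ≤ 10 * Real.log n by linarith)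
    linarith

lemma mutualInfo_le {n : ℕ} (hn : 2 ≤ n) {alg : List (Fin n × Bool) → Fin n → ℝ}
    (halg : IsAlg n alg) {Δ : ℝ} (h0 : 0 < Δ) (h1 : Δ < 1) (t : ℕ) :
    mutualInfo n t alg Δ ≤
      10 * Real.log n * (n : ℝ)⁻¹ * (t * (Δ * Real.log ((1 + Δ) / (1 - Δ)))) := by
  rw [mutualInfo, Finset.sum_comm, ← sum_nullHistP_mul_revDiv halg h0 h1, Finset.mul_sum]
  refine Finset.sum_le_sum fun h _ => ?_
  set l := hist h
  simp only [histP_eq_nullHistP_mul alg h0 h1, ← Finset.mul_sum]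
  rcases (nullHistP_nonneg halg h0 h1 l).eq_or_lt with hB | hB
  · simp [← hB]
  · set B := nullHistP n alg Δ l
    have key := sum_mul_log_div_mean_le hn (fun a => likRatio n Δ a l)
      fun a => likRatio_pos h0 h1 a l
    have hr : ∀ a, B * likRatio n Δ a l / ((n : ℝ)⁻¹ * (B * ∑ b, likRatio n Δ b l)) =
        likRatio n Δ a l / ((n : ℝ)⁻¹ * ∑ b, likRatio n Δ b l) := fun a => by
      rw [mul_left_comm, mul_div_mul_left _ _ hB.ne']
    have hw : 0 ≤ (n : ℝ)⁻¹ * B := by positivity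
    have := mul_le_mul_of_nonneg_left key hw
    rw [Finset.mul_sum] at this
    simp only [hr]
    calc _ = _ := Finset.sum_congr rfl fun a _ => by ring
      _ ≤ _ := this
      _ = _ := by rw [revDiv]; ring

/-- Converse for the mutual information: for every `ε ∈ (0,1)` there is `C > 0` such that
for all `n ≥ 2`, `Δ ∈ (0, 1-ε]` and all horizons `t`, `I*_t ≤ C t Δ² (log n) / n`. -/
theorem bandit_info_converse_all_t :
    ∀ ε : ℝ, ε ∈ Set.Ioo (0 : ℝ) 1 → ∃ C : ℝ, 0 < C ∧
      ∀ n : ℕ, 2 ≤ n → ∀ Δ : ℝ, Δ ∈ Set.Ioc (0 : ℝ) (1 - ε) →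
        ∀ t : ℕ, IStar n t Δ ≤ C * t * Δ ^ 2 * Real.log n / n := by
  rintro ε ⟨hε, -⟩
  refine ⟨20 / ε, by positivity, fun n hn Δ ⟨h0, hΔ⟩ t => ?_⟩
  have h1 : Δ < 1 := by linarith
  have hm : 0 < 1 - Δ := by linarith
  have hln : 0 ≤ Real.log n := Real.log_natCast_nonneg n
  have hlog : Real.log ((1 + Δ) / (1 - Δ)) ≤ 2 * Δ / ε :=
    calc Real.log ((1 + Δ) / (1 - Δ)) ≤ (1 + Δ) / (1 - Δ) - 1 :=
          Real.log_le_sub_one_of_pos (by positivity)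
      _ = 2 * Δ / (1 - Δ) := by field_simp; ring
      _ ≤ 2 * Δ / ε := by gcongr; linarith
  refine Real.sSup_le ?_ (by positivity)
  rintro _ ⟨alg, halg, rfl⟩
  calc mutualInfo n t alg Δ
      ≤ 10 * Real.log n * (n : ℝ)⁻¹ * (t * (Δ * Real.log ((1 + Δ) / (1 - Δ)))) :=
        mutualInfo_le hn halg h0 h1 t
    _ ≤ 10 * Real.log n * (n : ℝ)⁻¹ * (t * (Δ * (2 * Δ / ε))) := by gcongr
    _ = 20 / ε * t * Δ ^ 2 * Real.log n / n := by ring
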